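/- Let m ≥ 3 be an odd integer, let q ≥ 1, and let i_1, …, i_q be integers with 1 ≤ i_j ≤ m−1 for all j. For an integer u coprime to m, define the weight ⟨uα⟩ = Σ_{j=1}^q ( {u i_j/m} + {u i_j/m} + {−2u i_j/m} ), where {x} denotes the fractional part of the real number x. Suppose that ⟨uα⟩ = 3q/2 for every integer u coprime to m (so in particular q is even). Then the complex number (2πi)^{−q/2} · Π_{r=1}^q Γ(i_r/m)² · Γ(2 i_r/m)^{−1}, where Γ is the complex Gamma function, is algebraic over ℚ. -/

import Mathlib

open scoped Real
open Filter Topology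

lemma rpow_diff_bound {a b s c : ℝ} (hc : 0 < c) (hca : c ≤ a) (hab : a ≤ b)
    (hb : b ≤ a + 1) (hs : 1 ≤ s) :
    |1 / a ^ s - 1 / b ^ s| ≤ s * (1 / c ^ s) * (1 / c) := by
  have ha : 0 < a := lt_of_lt_of_le hc hca
  have hb0 : 0 < b := lt_of_lt_of_le ha hab
  have h1 : 1 + s * (a / b - 1) ≤ (1 + (a / b - 1)) ^ s :=
    one_add_mul_self_le_rpow_one_add (by have : 0 < a / b := by positivity
                                         linarith) hs
  have h2 : (1 + (a / b - 1)) ^ s = a ^ s / b ^ s := by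
    rw [← Real.div_rpow ha.le hb0.le]; congr 1; ring
  rw [h2] at h1
  have has : 0 < a ^ s := Real.rpow_pos_of_pos ha s
  have hbs : 0 < b ^ s := Real.rpow_pos_of_pos hb0 s
  have hcs : 0 < c ^ s := Real.rpow_pos_of_pos hc s
  have h3 : a ^ s ≤ b ^ s := Real.rpow_le_rpow ha.le hab (by linarith)
  have h4 : c ^ s ≤ a ^ s := Real.rpow_le_rpow hc.le hca (by linarith)
  rw [abs_of_nonneg (sub_nonneg.mpr (one_div_le_one_div_of_le has h3))]
  have h5 : 1 / a ^ s - 1 / b ^ s = 1 / a ^ s * (1 - a ^ s / b ^ s) := by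
    field_simp
  have h6 : 1 - a ^ s / b ^ s ≤ s * (1 / c) := by
    have : 1 - a ^ s / b ^ s ≤ s * (1 - a / b) := by linarith
    refine this.trans (mul_le_mul_of_nonneg_left ?_ (by linarith))
    have : 1 - a / b = (b - a) / b := by field_simp
    rw [this]
    exact div_le_div₀ (by norm_num) (by linarith) hc (by linarith)
  rw [h5]
  calc 1 / a ^ s * (1 - a ^ s / b ^ s) ≤ 1 / c ^ s * (s * (1 / c)) := by
        apply mul_le_mul (one_div_le_one_div_of_le hcs h4) h6 _ (by positivity)
        rw [sub_nonneg, div_le_one hbs]; exact h3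
    _ = _ := by ring

lemma rpow_term_bound {x : ℝ} (hx0 : 0 < x) (hx1 : x < 1) {s : ℝ} (hs1 : 1 ≤ s) (hs2 : s ≤ 2)
    (n : ℕ) :
    |1 / (n + x) ^ s - 1 / (n + 1 - x) ^ s| ≤
      (2 * (1 / (min x (1 - x)) ^ (3 : ℕ))) * (1 / ((n : ℝ) + 1) ^ 2) := by
  set δ := min x (1 - x) with hδ
  have hδ0 : 0 < δ := lt_min hx0 (by linarith)
  have hδx : δ ≤ x := min_le_left _ _
  have hδ1x : δ ≤ 1 - x := min_le_right _ _
  have hδ1 : δ ≤ 1 := by linarith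
  have hn : (0 : ℝ) ≤ n := Nat.cast_nonneg n
  have hδn : δ * n ≤ n := by nlinarith
  have hc : 0 < δ * (n + 1) := by positivity
  have key : |1 / (n + x) ^ s - 1 / (n + 1 - x) ^ s| ≤
      s * (1 / (δ * (n + 1)) ^ s) * (1 / (δ * (n + 1))) := by
    rcases le_total x (1 - x) with h | h
    · exact rpow_diff_bound hc (by nlinarith) (by linarith) (by linarith) hs1
    · rw [abs_sub_comm]
      exact rpow_diff_bound hc (by nlinarith) (by linarith) (by linarith) hs1
  refine key.trans ?_
  have e1 : (δ * (n + 1)) ^ s = δ ^ s * (n + 1 : ℝ) ^ s :=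
    Real.mul_rpow hδ0.le (by positivity)
  have e2 : δ ^ 2 ≤ δ ^ s := by
    have := Real.rpow_le_rpow_of_exponent_ge hδ0 hδ1 hs2
    simpa using this
  have e3 : (n + 1 : ℝ) ≤ (n + 1 : ℝ) ^ s := by
    have := Real.rpow_le_rpow_of_exponent_le (x := (n + 1 : ℝ)) (by linarith) hs1
    simpa using this
  have e4 : δ ^ 2 * (n + 1 : ℝ) ≤ (δ * (n + 1)) ^ s := by
    rw [e1]; exact mul_le_mul e2 e3 (by positivity) (by positivity)
  calc s * (1 / (δ * (n + 1)) ^ s) * (1 / (δ * (n + 1)))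
      ≤ 2 * (1 / (δ ^ 2 * (n + 1 : ℝ))) * (1 / (δ * (n + 1))) := by
        gcongr
    _ = _ := by field_simp

lemma hurwitzZetaOdd_one_eq {x : ℝ} (hx0 : 0 < x) (hx1 : x < 1) :
    HurwitzZeta.hurwitzZetaOdd (x : UnitAddCircle) 1 =
      (π / 2 : ℂ) * Complex.cot (π * x) := by
  -- real-variable terms
  let f : ℝ → ℕ → ℝ := fun s n => (1 / (n + x) ^ s - 1 / (n + 1 - x) ^ s) / 2
  have hpos1 : ∀ n : ℕ, 0 < (n : ℝ) + x := fun n => by positivity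
  have hpos2 : ∀ n : ℕ, 0 < (n : ℝ) + 1 - x := fun n => by
    have : (0 : ℝ) ≤ n := Nat.cast_nonneg n
    linarith
  have hf : ∀ s : ℝ, 1 < s →
      HasSum (fun n => ((f s n : ℝ) : ℂ)) (HurwitzZeta.hurwitzZetaOdd (x : UnitAddCircle) s) := by
    intro s hs
    refine (HurwitzZeta.hasSum_nat_hurwitzZetaOdd_of_mem_Icc ⟨hx0.le, hx1.le⟩
      (s := (s : ℂ)) (by simpa using hs)).congr_fun fun n => ?_
    simp only [f]
    push_cast
    rw [Complex.ofReal_cpow (hpos1 n).le, Complex.ofReal_cpow (hpos2 n).le]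
    push_cast
    rfl
  have hbd : Summable fun n : ℕ =>
      (2 * (1 / (min x (1 - x)) ^ (3 : ℕ))) * (1 / ((n : ℝ) + 1) ^ 2) := by
    apply Summable.mul_left
    have := (summable_nat_add_iff 1).mpr (Real.summable_one_div_nat_pow.mpr (one_lt_two))
    simpa using this
  have hfb : ∀ s : ℝ, 1 ≤ s → s ≤ 2 → ∀ n, ‖((f s n : ℝ) : ℂ)‖ ≤
      (2 * (1 / (min x (1 - x)) ^ (3 : ℕ))) * (1 / ((n : ℝ) + 1) ^ 2) := by
    intro s h1 h2 n
    rw [Complex.norm_real, Real.norm_eq_abs]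
    simp only [f]
    rw [abs_div, abs_two]
    have := rpow_term_bound hx0 hx1 h1 h2 n
    have h0 := abs_nonneg (1 / ((n : ℝ) + x) ^ s - 1 / ((n : ℝ) + 1 - x) ^ s)
    linarith
  have hlim : Tendsto (fun s : ℝ => ∑' n, ((f s n : ℝ) : ℂ)) (𝓝[>] 1)
      (𝓝 (∑' n, ((f 1 n : ℝ) : ℂ))) := by
    refine tendsto_tsum_of_dominated_convergence hbd ?_ ?_
    · intro n
      refine (Complex.continuous_ofReal.tendsto _).comp ?_
      refine Tendsto.mono_left (ContinuousAt.tendsto ?_) nhdsWithin_le_nhds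
      simp only [f]
      have h1 := (Real.continuous_const_rpow (hpos1 n).ne').continuousAt (x := (1 : ℝ))
      have h2 := (Real.continuous_const_rpow (hpos2 n).ne').continuousAt (x := (1 : ℝ))
      refine ((continuousAt_const.div h1 ?_).sub (continuousAt_const.div h2 ?_)).div_const 2
      · exact (Real.rpow_pos_of_pos (hpos1 n) _).ne'
      · exact (Real.rpow_pos_of_pos (hpos2 n) _).ne'
    · have : Set.Ioc (1 : ℝ) 2 ∈ 𝓝[>] (1 : ℝ) := Ioc_mem_nhdsGT one_lt_two
      filter_upwards [this] with s hs n
      exact hfb s hs.1.le hs.2 n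
  have hlim2 : Tendsto (fun s : ℝ => HurwitzZeta.hurwitzZetaOdd (x : UnitAddCircle) s) (𝓝[>] 1)
      (𝓝 (HurwitzZeta.hurwitzZetaOdd (x : UnitAddCircle) 1)) := by
    have hc : Continuous fun s : ℝ => HurwitzZeta.hurwitzZetaOdd (x : UnitAddCircle) s :=
      (HurwitzZeta.differentiable_hurwitzZetaOdd _).continuous.comp Complex.continuous_ofReal
    have := (hc.tendsto 1).mono_left (nhdsWithin_le_nhds (s := Set.Ioi (1 : ℝ)))
    simpa using this
  have heq : HurwitzZeta.hurwitzZetaOdd (x : UnitAddCircle) 1 = ∑' n, ((f 1 n : ℝ) : ℂ) := by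
    refine tendsto_nhds_unique hlim2 (hlim.congr' ?_)
    filter_upwards [self_mem_nhdsWithin] with s hs
    exact (hf s hs).tsum_eq
  have hsum1 : HasSum (fun n => ((f 1 n : ℝ) : ℂ)) (∑' n, ((f 1 n : ℝ) : ℂ)) :=
    (Summable.of_norm_bounded hbd (hfb 1 le_rfl one_le_two)).hasSum
  have hz : (x : ℂ) ∈ Complex.integerComplement := by
    rw [Complex.mem_integerComplement_iff]
    rintro ⟨n, hn⟩
    have hn' : (n : ℝ) = x := by exact_mod_cast hn
    rw [← hn'] at hx0 hx1
    have h1 : 0 < n := by exact_mod_cast hx0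
    have h2 : n < 1 := by exact_mod_cast hx1
    omega
  have hcot := tendsto_logDeriv_euler_cot_sub hz
  have ht := hsum1.tendsto_sum_nat
  -- partial sums comparison
  have hps : ∀ N : ℕ, ∑ n ∈ Finset.range N, ((f 1 n : ℝ) : ℂ) =
      ((∑ n ∈ Finset.range N, (1 / ((x : ℂ) - (n + 1)) + 1 / ((x : ℂ) + (n + 1)))) + 1 / x
        - 1 / (x + N)) / 2 := by
    intro N
    induction N with
    | zero => simp
    | succ N ih =>
      rw [Finset.sum_range_succ, Finset.sum_range_succ, ih]
      simp only [f, Real.rpow_one]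
      push_cast
      have h3 : (x : ℂ) - (N + 1) = -((N : ℂ) + 1 - x) := by ring
      rw [h3, one_div_neg_eq_neg_one_div]
      rw [show (N : ℂ) + x = x + N by ring]
      ring
  have hlast : Tendsto (fun N : ℕ => 1 / ((x : ℂ) + N)) atTop (𝓝 0) := by
    have h1 : Tendsto (fun N : ℕ => 1 / (x + (N : ℝ))) atTop (𝓝 0) := by
      simp only [one_div]
      exact tendsto_inv_atTop_zero.comp
        (tendsto_atTop_add_const_left _ _ tendsto_natCast_atTop_atTop)
    have := (Complex.continuous_ofReal.tendsto _).comp h1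
    simpa [Function.comp_def] using this
  have ht2 := ((hcot.add_const (1 / (x : ℂ))).sub hlast).div_const 2
  rw [heq]
  refine (tendsto_nhds_unique ht (ht2.congr fun N => ?_)).trans ?_
  · rw [hps]
  · ring

/-- Distribution relations on `ZMod m` (away from the fibre over zero). -/
def IsDistr (m : ℕ) (g : ZMod m → ℂ) : Prop :=
  ∀ d e : ℕ, d * e = m → ∀ y : ZMod m, (d : ZMod m) * y ≠ 0 →
    ∑ k ∈ Finset.range d, g (y + (k : ZMod m) * (e : ZMod m)) = g ((d : ZMod m) * y)

lemma exists_unit_lift {m : ℕ} [NeZero m] {n e t : ℕ} (hne : n * e = m) (ht : Nat.Coprime t n) :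
    ∃ u : (ZMod m)ˣ, (u : ZMod m) * (e : ZMod m) = (t : ZMod m) * (e : ZMod m) ∧
      (u : ZMod m).val ≡ t [MOD n] := by
  have hnm : n ∣ m := ⟨e, hne.symm⟩
  have : NeZero n := ⟨fun h => NeZero.ne m (by rw [← hne, h, zero_mul])⟩
  obtain ⟨u, hu⟩ := ZMod.unitsMap_surjective hnm (ZMod.unitOfCoprime t ht)
  have h1 : (u : ZMod m).val ≡ t [MOD n] := by
    have h2 := congrArg (fun v : (ZMod n)ˣ => (v : ZMod n)) hu
    simp only [ZMod.unitsMap_val, ZMod.coe_unitOfCoprime] at h2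
    rw [ZMod.cast_eq_val] at h2
    exact (ZMod.natCast_eq_natCast_iff _ _ _).mp h2
  refine ⟨u, ?_, h1⟩
  have h3 : (u : ZMod m).val * e ≡ t * e [MOD n * e] := Nat.ModEq.mul_right' e h1
  rw [hne] at h3
  have h4 := (ZMod.natCast_eq_natCast_iff _ _ _).mpr h3
  push_cast at h4
  rwa [ZMod.natCast_zmod_val] at h4

lemma distr_uniq {m : ℕ} [NeZero m] (χ : DirichletCharacter ℂ m) (hχ1 : χ ≠ 1)
    (g : ZMod m → ℂ) (hg : IsDistr m g)
    (heq : ∀ (u : (ZMod m)ˣ) (a : ZMod m), g (u * a) = χ u * g a)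
    (h0 : g ((m / χ.conductor : ℕ) : ZMod m) = 0) : ∀ a, g a = 0 := by
  have hm : 0 < m := Nat.pos_of_ne_zero (NeZero.ne m)
  have hff : χ.FactorsThrough χ.conductor := χ.factorsThrough_conductor
  have claim : ∀ n : ℕ, ∀ e : ℕ, n * e = m → g (e : ZMod m) = 0 := by
    intro n
    induction n using Nat.strong_induction_on with
    | _ n ih =>
    intro e hne
    have hn0 : 0 < n := Nat.pos_of_ne_zero (fun h => hm.ne' (by rw [← hne, h, zero_mul]))
    have he0 : 0 < e := Nat.pos_of_ne_zero (fun h => hm.ne' (by rw [← hne, h, mul_zero]))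
    have hnm : n ∣ m := ⟨e, hne.symm⟩
    by_cases hfac : χ.FactorsThrough n
    · obtain ⟨d, hd⟩ := DirichletCharacter.conductor_dvd_of_mem_conductorSet χ hfac
      set f := χ.conductor with hf
      have hf1 : 1 < f := by
        have h1 : f ≠ 0 := DirichletCharacter.conductor_ne_zero χ
        have h2 : f ≠ 1 := fun h => hχ1 ((DirichletCharacter.eq_one_iff_conductor_eq_one).mpr h)
        omega
      have hd0 : 0 < d := Nat.pos_of_ne_zero (fun h => hn0.ne' (by rw [hd, h, mul_zero]))
      have hmf : m / f = d * e := by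
        rw [← hne, hd, mul_assoc, Nat.mul_div_cancel_left _ (by omega)]
      have hde : d * (f * e) = m := by rw [← hne, hd]; ring
      have hne0 : (d : ZMod m) * (e : ZMod m) ≠ 0 := by
        rw [← Nat.cast_mul, Ne, ZMod.natCast_eq_zero_iff]
        intro hdvd
        have hle := Nat.le_of_dvd (by positivity) hdvd
        have : m = f * (d * e) := by rw [← hde]; ring
        have hpos : 0 < d * e := by positivity
        nlinarith
      have hsum := hg d (f * e) hde e hne0
      rw [← Nat.cast_mul, ← hmf, h0] at hsum
      have hterm : ∀ k ∈ Finset.range d,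
          g ((e : ZMod m) + (k : ZMod m) * ((f * e : ℕ) : ZMod m)) =
          (if Nat.Coprime (1 + k * f) n then (1 : ℂ) else 0) * g e := by
        intro k _
        have hre : (e : ZMod m) + (k : ZMod m) * ((f * e : ℕ) : ZMod m) =
            ((1 + k * f : ℕ) : ZMod m) * (e : ZMod m) := by push_cast; ring
        rw [hre]
        split_ifs with hcop
        · obtain ⟨u, hu1, hu2⟩ := exists_unit_lift hne hcop
          rw [← hu1, heq]
          congr 1
          have hker := (DirichletCharacter.factorsThrough_iff_ker_unitsMap hff.dvd).mp hff
          have hmem : u ∈ (ZMod.unitsMap hff.dvd).ker := by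
            rw [MonoidHom.mem_ker]
            ext
            rw [ZMod.unitsMap_val, ZMod.cast_eq_val]
            have h5 : (u : ZMod m).val ≡ 1 + k * f [MOD f] :=
              hu2.of_dvd ⟨d, hd⟩
            have h6 := (ZMod.natCast_eq_natCast_iff _ _ _).mpr h5
            change (((u : ZMod m).val : ℕ) : ZMod f) = _
            rw [h6]
            simp
          have h7 := hker hmem
          rw [MonoidHom.mem_ker] at h7
          have h8 := congrArg (fun v : ℂˣ => (v : ℂ)) h7
          simpa using h8
        · rw [zero_mul]
          set p := Nat.gcd (1 + k * f) n with hp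
          have hp0 : 0 < p := Nat.gcd_pos_of_pos_right _ hn0
          have hp1 : p ≠ 1 := hcop
          obtain ⟨t', ht'⟩ := Nat.gcd_dvd_left (1 + k * f) n
          obtain ⟨n', hn'⟩ := Nat.gcd_dvd_right (1 + k * f) n
          rw [← hp] at ht' hn'
          have hcop' : Nat.Coprime t' n' := by
            have := Nat.coprime_div_gcd_div_gcd (m := 1 + k * f) (n := n) hp0
            rw [← hp] at this
            rwa [ht', Nat.mul_div_cancel_left _ hp0, hn', Nat.mul_div_cancel_left _ hp0] at this
          have hn'0 : 0 < n' := Nat.pos_of_ne_zero (fun h => hn0.ne' (by rw [hn', h, mul_zero]))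
          have hlt : n' < n := by
            have : 2 ≤ p := by omega
            rw [hn']; nlinarith
          have hne' : n' * (p * e) = m := by rw [← hne, hn']; ring
          obtain ⟨u, hu1, -⟩ := exists_unit_lift hne' hcop'
          have : ((1 + k * f : ℕ) : ZMod m) * (e : ZMod m) = u * ((p * e : ℕ) : ZMod m) := by
            rw [hu1, ht']; push_cast; ring
          rw [this, heq, ih n' hlt _ hne', mul_zero]
      rw [Finset.sum_congr rfl hterm, ← Finset.sum_mul] at hsum
      rcases mul_eq_zero.mp hsum with h | h
      · exfalso
        rw [Finset.sum_boole] at h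
        have h9 : (Finset.range d).filter (fun k => Nat.Coprime (1 + k * f) n) = ∅ := by
          rw [← Finset.card_eq_zero]; exact_mod_cast h
        have : 0 ∈ (Finset.range d).filter (fun k => Nat.Coprime (1 + k * f) n) := by
          simp [hd0]
        rw [h9] at this
        simp at this
      · exact h
    · rw [DirichletCharacter.factorsThrough_iff_ker_unitsMap hnm, SetLike.not_le_iff_exists] at hfac
      obtain ⟨u, hu, hu'⟩ := hfac
      rw [MonoidHom.mem_ker] at hu hu'
      have h1 : (u : ZMod m).val ≡ 1 [MOD n] := by
        have h2 := congrArg (fun v : (ZMod n)ˣ => (v : ZMod n)) hu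
        simp only [ZMod.unitsMap_val, Units.val_one] at h2
        rw [ZMod.cast_eq_val] at h2
        exact (ZMod.natCast_eq_natCast_iff _ _ _).mp (by simpa using h2)
      have h3 : (u : ZMod m).val * e ≡ 1 * e [MOD n * e] := Nat.ModEq.mul_right' e h1
      rw [hne] at h3
      have h4 := (ZMod.natCast_eq_natCast_iff _ _ _).mpr h3
      push_cast at h4
      rw [ZMod.natCast_zmod_val, one_mul] at h4
      have h5 := heq u e
      rw [h4] at h5
      have h6 : χ u ≠ 1 := by
        intro h
        apply hu'
        ext
        simpa using h
      have h7 : (χ u - 1) * g e = 0 := by rw [sub_mul, ← h5]; ring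
      exact (mul_eq_zero.mp h7).resolve_left (sub_ne_zero.mpr h6)
  intro a
  obtain ⟨d, ⟨n, hn⟩, u, hu, rfl⟩ := ZMod.eq_unit_mul_divisor a
  obtain ⟨v, rfl⟩ := hu
  rw [heq, claim n d (by rw [hn]; ring), mul_zero]

lemma sum_zmod_eq_range {m : ℕ} [NeZero m] (F : ℕ → ℂ) :
    ∑ a : ZMod m, F a.val = ∑ k ∈ Finset.range m, F k := by
  refine Finset.sum_bij' (fun a _ => a.val) (fun k _ => (k : ZMod m)) ?_ ?_ ?_ ?_ ?_
  · intro a _; exact Finset.mem_range.mpr (ZMod.val_lt a)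
  · intro k _; exact Finset.mem_univ _
  · intro a _; exact ZMod.natCast_zmod_val a
  · intro k hk; exact ZMod.val_natCast_of_lt (Finset.mem_range.mp hk)
  · intro a _; rfl

lemma ker_sum {m : ℕ} [NeZero m] {d e : ℕ} (hde : d * e = m) (F : ZMod m → ℂ) :
    ∑ x : ZMod m with (d : ZMod m) * x = 0, F x =
      ∑ k ∈ Finset.range d, F ((k : ZMod m) * (e : ZMod m)) := by
  have hm : 0 < m := Nat.pos_of_ne_zero (NeZero.ne m)
  have hd0 : 0 < d := Nat.pos_of_ne_zero (fun h => hm.ne' (by rw [← hde, h, zero_mul]))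
  have he0 : 0 < e := Nat.pos_of_ne_zero (fun h => hm.ne' (by rw [← hde, h, mul_zero]))
  have hval : ∀ k, k < d → ((k : ZMod m) * (e : ZMod m)).val = k * e := by
    intro k hk
    rw [← Nat.cast_mul]
    exact ZMod.val_natCast_of_lt (by rw [← hde]; exact Nat.mul_lt_mul_of_pos_right hk he0)
  symm
  refine Finset.sum_bij (fun k _ => (k : ZMod m) * (e : ZMod m)) ?_ ?_ ?_ ?_
  · intro k _
    rw [Finset.mem_filter]
    refine ⟨Finset.mem_univ _, ?_⟩
    have : (d : ZMod m) * ((k : ZMod m) * (e : ZMod m)) = (k : ZMod m) * ((d * e : ℕ) : ZMod m) := by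
      push_cast; ring
    rw [this, hde, ZMod.natCast_self, mul_zero]
  · intro k hk l hl h
    have := congrArg ZMod.val h
    rw [hval k (Finset.mem_range.mp hk), hval l (Finset.mem_range.mp hl)] at this
    exact Nat.eq_of_mul_eq_mul_right he0 this
  · intro x hx
    have hx := (Finset.mem_filter.mp hx).2
    have h1 : ((d * x.val : ℕ) : ZMod m) = 0 := by
      push_cast; rw [ZMod.natCast_zmod_val]; exact hx
    rw [ZMod.natCast_eq_zero_iff] at h1
    obtain ⟨k, hk⟩ : e ∣ x.val := by
      have : d * e ∣ d * x.val := by rw [hde]; exact h1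
      exact Nat.dvd_of_mul_dvd_mul_left hd0 this
    refine ⟨k, ?_, ?_⟩
    · rw [Finset.mem_range]
      have := ZMod.val_lt x
      rw [hk, ← hde, mul_comm d e] at this
      exact Nat.lt_of_mul_lt_mul_left this
    · rw [← ZMod.natCast_zmod_val x, hk]; push_cast; ring
  · intro k _; rfl

lemma isDistr_iff {m : ℕ} [NeZero m] (g : ZMod m → ℂ) :
    IsDistr m g ↔ ∀ d e : ℕ, d * e = m → ∀ y : ZMod m, (d : ZMod m) * y ≠ 0 →
      ∑ x : ZMod m with (d : ZMod m) * x = 0, g (y + x) = g ((d : ZMod m) * y) := by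
  refine forall_congr' fun d => forall_congr' fun e => forall_congr' fun hde => ?_
  refine forall_congr' fun y => ?_
  rw [ker_sum hde (fun x => g (y + x))]

lemma IsDistr.unit_mul {m : ℕ} [NeZero m] {g : ZMod m → ℂ} (hg : IsDistr m g) (u : (ZMod m)ˣ) :
    IsDistr m (fun a => g (u * a)) := by
  rw [isDistr_iff] at hg ⊢
  intro d e hde y hy
  have hy' : (d : ZMod m) * (u * y) ≠ 0 := by
    intro h
    apply hy
    have : (u : ZMod m) * (d * y) = 0 := by rw [← h]; ring
    exact (Units.mul_right_eq_zero u).mp this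
  have h1 := hg d e hde (u * y) hy'
  rw [show (u : ZMod m) * (d * y) = d * (u * y) by ring, ← h1]
  refine Finset.sum_bij' (fun x _ => (u : ZMod m) * x) (fun x _ => ((u⁻¹ : (ZMod m)ˣ) : ZMod m) * x)
    ?_ ?_ ?_ ?_ ?_
  · intro x hx
    rw [Finset.mem_filter] at hx ⊢
    refine ⟨Finset.mem_univ _, ?_⟩
    rw [mul_left_comm, hx.2, mul_zero]
  · intro x hx
    rw [Finset.mem_filter] at hx ⊢
    refine ⟨Finset.mem_univ _, ?_⟩
    rw [mul_left_comm, hx.2, mul_zero]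
  · intro x _; simp
  · intro x _; simp
  · intro x _; simp only [mul_add]

lemma IsDistr.sum {m : ℕ} {ι : Type*} (s : Finset ι) (c : ι → ℂ) (g : ι → ZMod m → ℂ)
    (hg : ∀ i ∈ s, IsDistr m (g i)) : IsDistr m (fun a => ∑ i ∈ s, c i * g i a) := by
  intro d e hde y hy
  rw [Finset.sum_comm]
  refine Finset.sum_congr rfl fun i hi => ?_
  rw [← Finset.mul_sum, hg i hi d e hde y hy]

lemma IsDistr.lin {m : ℕ} {g h : ZMod m → ℂ} (hg : IsDistr m g) (hh : IsDistr m h) (c c' : ℂ) :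
    IsDistr m (fun a => c * g a - c' * h a) := by
  intro d e hde y hy
  rw [Finset.sum_sub_distrib, ← Finset.mul_sum, ← Finset.mul_sum, hg d e hde y hy,
    hh d e hde y hy]

lemma distr_of_nat {m : ℕ} [NeZero m] (G : ℕ → ℂ)
    (hG : ∀ d e : ℕ, d * e = m → ∀ t : ℕ, 0 < t → t < e →
      ∑ k ∈ Finset.range d, G (t + k * e) = G (d * t)) :
    IsDistr m (fun a => if a = 0 then 0 else G a.val) := by
  rw [isDistr_iff]
  intro d e hde y hy
  have hm : 0 < m := Nat.pos_of_ne_zero (NeZero.ne m)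
  have hd0 : 0 < d := Nat.pos_of_ne_zero (fun h => hm.ne' (by rw [← hde, h, zero_mul]))
  have he0 : 0 < e := Nat.pos_of_ne_zero (fun h => hm.ne' (by rw [← hde, h, mul_zero]))
  set t := y.val % e with ht
  set j := y.val / e with hj
  have hyt : y = (t : ZMod m) + (j : ZMod m) * (e : ZMod m) := by
    have h1 : t + j * e = y.val := by rw [ht, hj, mul_comm]; exact Nat.mod_add_div _ _
    rw [← ZMod.natCast_zmod_val y, ← h1]; push_cast; rfl
  have hdje : (d : ZMod m) * ((j : ZMod m) * (e : ZMod m)) = 0 := by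
    have : (d : ZMod m) * ((j : ZMod m) * (e : ZMod m)) = (j : ZMod m) * ((d * e : ℕ) : ZMod m) := by
      push_cast; ring
    rw [this, hde, ZMod.natCast_self, mul_zero]
  have hdy : (d : ZMod m) * y = ((d * t : ℕ) : ZMod m) := by
    rw [hyt, mul_add, hdje]; push_cast; ring
  have hte : t < e := Nat.mod_lt _ he0
  have ht0 : 0 < t := by
    rcases Nat.eq_zero_or_pos t with h | h
    · exfalso; apply hy; rw [hdy, h]; simp
    · exact h
  have hshift : ∑ x : ZMod m with (d : ZMod m) * x = 0,
        (fun a : ZMod m => if a = 0 then (0 : ℂ) else G a.val) (y + x) =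
      ∑ x : ZMod m with (d : ZMod m) * x = 0,
        (fun a : ZMod m => if a = 0 then (0 : ℂ) else G a.val) ((t : ZMod m) + x) := by
    refine Finset.sum_bij' (fun x _ => (j : ZMod m) * (e : ZMod m) + x)
      (fun x _ => x - (j : ZMod m) * (e : ZMod m)) ?_ ?_ ?_ ?_ ?_
    · intro x hx
      rw [Finset.mem_filter] at hx ⊢
      exact ⟨Finset.mem_univ _, by rw [mul_add, hdje, hx.2, add_zero]⟩
    · intro x hx
      rw [Finset.mem_filter] at hx ⊢
      exact ⟨Finset.mem_univ _, by rw [mul_sub, hdje, hx.2, sub_zero]⟩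
    · intro x _; ring
    · intro x _; ring
    · intro x _
      rw [hyt, add_assoc]
  rw [hshift, ker_sum hde (fun x => (fun a : ZMod m => if a = 0 then (0 : ℂ) else G a.val)
    ((t : ZMod m) + x)), hdy]
  have hcast : ∀ n : ℕ, 0 < n → n < m →
      (fun a : ZMod m => if a = 0 then (0 : ℂ) else G a.val) (n : ZMod m) = G n := by
    intro n h1 h2
    have hv : ((n : ZMod m)).val = n := ZMod.val_natCast_of_lt h2
    have hne : (n : ZMod m) ≠ 0 := by
      intro h; rw [h, ZMod.val_zero] at hv; omega
    simp only [hne, if_false, hv]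
  refine Eq.trans ?_ ((hG d e hde t ht0 hte).trans (hcast (d * t) (by positivity)
    (by rw [← hde]; exact Nat.mul_lt_mul_of_pos_left hte hd0)).symm)
  refine Finset.sum_congr rfl fun k hk => ?_
  rw [← hcast (t + k * e) (by positivity) ?_]
  · push_cast; rfl
  · have hk' : k + 1 ≤ d := Finset.mem_range.mp hk
    calc t + k * e < e + k * e := by omega
      _ = (k + 1) * e := by ring
      _ ≤ d * e := Nat.mul_le_mul_right e hk'
      _ = m := hde

/-- The odd first Bernoulli distribution on `ZMod m`. -/
noncomputable def bf (m : ℕ) (a : ZMod m) : ℂ := if a = 0 then 0 else (a.val : ℂ) / m - 1 / 2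

lemma bf_distr (m : ℕ) [NeZero m] : IsDistr m (bf m) := by
  refine distr_of_nat (fun n => (n : ℂ) / m - 1 / 2) ?_
  intro d e hde t _ _
  have hm : (m : ℂ) ≠ 0 := Nat.cast_ne_zero.mpr (NeZero.ne m)
  have hde' : (d : ℂ) * e = m := by rw [← hde]; push_cast; ring
  have key : ∀ n : ℕ, ∑ k ∈ Finset.range n, (((t + k * e : ℕ) : ℂ) / m - 1 / 2) =
      (n * t + (n * (n - 1) / 2) * e) / m - n / 2 := by
    intro n
    induction n with
    | zero => simp
    | succ n ih => rw [Finset.sum_range_succ, ih]; push_cast; ring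
  rw [key d]
  push_cast
  have : (d : ℂ) * (d - 1) / 2 * e = (d - 1) / 2 * m := by rw [← hde']; ring
  rw [this]
  field_simp
  ring

lemma sum_mul_pow (z : ℂ) (n : ℕ) :
    (∑ k ∈ Finset.range n, (k : ℂ) * z ^ k) * (z - 1) =
      n * z ^ n - z * ∑ k ∈ Finset.range n, z ^ k := by
  induction n with
  | zero => simp
  | succ n ih =>
    rw [Finset.sum_range_succ, Finset.sum_range_succ, add_mul, ih]; push_cast; ring

lemma sum_char_bf {m : ℕ} [NeZero m] (b : ZMod m) (hb : b ≠ 0) :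
    ∑ a : ZMod m, ZMod.stdAddChar (a * b) * bf m a =
      -(Complex.I / 2) * Complex.cot (π * ((b.val : ℝ) / (m : ℝ) : ℝ)) := by
  have hm : (m : ℂ) ≠ 0 := Nat.cast_ne_zero.mpr (NeZero.ne m)
  set z : ℂ := ZMod.stdAddChar b with hz
  have hpow : ∀ a : ZMod m, ZMod.stdAddChar (a * b) = z ^ a.val := by
    intro a
    rw [hz, ← AddChar.map_nsmul_eq_pow, nsmul_eq_mul, ZMod.natCast_zmod_val]
  have hz1 : z ≠ 1 := by
    intro h
    apply hb
    apply ZMod.injective_stdAddChar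
    rw [← hz, h, AddChar.map_zero_eq_one]
  have hzm : z ^ m = 1 := by
    rw [hz, ← AddChar.map_nsmul_eq_pow, nsmul_eq_mul, ZMod.natCast_self, zero_mul,
      AddChar.map_zero_eq_one]
  have hgeom : ∑ k ∈ Finset.range m, z ^ k = 0 := by
    rw [geom_sum_eq hz1, hzm]; simp
  have hs := sum_mul_pow z m
  rw [hgeom, hzm, mul_one, mul_zero, sub_zero] at hs
  have hz1' : z - 1 ≠ 0 := sub_ne_zero.mpr hz1
  have e1 : ∑ a : ZMod m, ZMod.stdAddChar (a * b) * bf m a =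
      ∑ a : ZMod m, (z ^ a.val * ((a.val : ℂ) / m - 1 / 2) + if a = 0 then 1 / 2 else 0) := by
    refine Finset.sum_congr rfl fun a _ => ?_
    rw [hpow, bf]
    split_ifs with h
    · rw [h]; simp
    · ring
  have e2 : ∑ k ∈ Finset.range m, z ^ k * ((k : ℂ) / m - 1 / 2) = 1 / (z - 1) := by
    have : ∀ k ∈ Finset.range m, z ^ k * ((k : ℂ) / m - 1 / 2) =
        (1 / m) * ((k : ℂ) * z ^ k) - 1 / 2 * z ^ k := fun k _ => by ring
    rw [Finset.sum_congr rfl this, Finset.sum_sub_distrib, ← Finset.mul_sum, ← Finset.mul_sum,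
      hgeom, mul_zero, sub_zero, eq_div_iff hz1', mul_assoc, hs]
    field_simp
  rw [e1, Finset.sum_add_distrib, sum_zmod_eq_range (fun k => z ^ k * ((k : ℂ) / m - 1 / 2)), e2,
    Finset.sum_ite_eq' Finset.univ (0 : ZMod m), if_pos (Finset.mem_univ _),
    Complex.cot_eq_exp_ratio]
  have hexp : Complex.exp (2 * Complex.I * (π * ((b.val : ℝ) / (m : ℝ) : ℝ))) = z := by
    rw [hz]
    have := ZMod.stdAddChar_coe (N := m) (b.val : ℤ)
    rw [Int.cast_natCast, ZMod.natCast_zmod_val] at this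
    rw [this]
    congr 1
    push_cast
    ring
  rw [hexp]
  have : (1 - z) ≠ 0 := sub_ne_zero.mpr hz1.symm
  have hI : Complex.I ≠ 0 := Complex.I_ne_zero
  field_simp
  ring

/-- The `χ`-component (up to the factor `φ(m)`) of a function on `ZMod m`. -/
noncomputable def proj {m : ℕ} [NeZero m] (χ : DirichletCharacter ℂ m) (g : ZMod m → ℂ)
    (a : ZMod m) : ℂ :=
  ∑ u : (ZMod m)ˣ, χ ((u⁻¹ : (ZMod m)ˣ) : ZMod m) * g (u * a)

lemma proj_equiv {m : ℕ} [NeZero m] (χ : DirichletCharacter ℂ m) (g : ZMod m → ℂ)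
    (v : (ZMod m)ˣ) (a : ZMod m) : proj χ g (v * a) = χ v * proj χ g a := by
  unfold proj
  rw [Finset.mul_sum]
  refine Fintype.sum_equiv (Equiv.mulRight v) _ _ fun u => ?_
  simp only [Equiv.coe_mulRight, mul_inv, Units.val_mul, map_mul]
  rw [← mul_assoc (u : ZMod m)]
  have : χ (v : ZMod m) * χ ((v⁻¹ : (ZMod m)ˣ) : ZMod m) = 1 := by
    rw [← map_mul, Units.mul_inv, map_one]
  linear_combination (-(χ ((u⁻¹ : (ZMod m)ˣ) : ZMod m) * g ((u : ZMod m) * v * a))) * this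

lemma proj_distr {m : ℕ} [NeZero m] (χ : DirichletCharacter ℂ m) {g : ZMod m → ℂ}
    (hg : IsDistr m g) : IsDistr m (proj χ g) :=
  IsDistr.sum Finset.univ (fun u : (ZMod m)ˣ => χ ((u⁻¹ : (ZMod m)ˣ) : ZMod m))
    (fun (u : (ZMod m)ˣ) (a : ZMod m) => g (u * a)) (fun u _ => hg.unit_mul u)

lemma proj_even {m : ℕ} [NeZero m] (χ : DirichletCharacter ℂ m) (hχ : χ.Even) {g : ZMod m → ℂ}
    (hg : ∀ a, g (-a) = -g a) (a : ZMod m) : proj χ g a = 0 := by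
  have h1 : proj χ g (((-1 : (ZMod m)ˣ) : ZMod m) * a) = -proj χ g a := by
    unfold proj
    rw [← Finset.sum_neg_distrib]
    refine Finset.sum_congr rfl fun u _ => ?_
    rw [← mul_neg, ← hg]
    simp
  have h2 := proj_equiv χ g (-1) a
  have h3 : χ (((-1 : (ZMod m)ˣ) : ZMod m)) = 1 := by
    rw [Units.val_neg, Units.val_one]; exact hχ
  rw [h1, h3, one_mul] at h2
  have : (2 : ℂ) * proj χ g a = 0 := by linear_combination -h2
  simpa using this

lemma sum_proj {m : ℕ} [NeZero m] (g : ZMod m → ℂ) (a : ZMod m) :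
    ∑ χ : DirichletCharacter ℂ m, proj χ g a = (m.totient : ℂ) * g a := by
  unfold proj
  rw [Finset.sum_comm]
  simp_rw [← Finset.sum_mul, DirichletCharacter.sum_characters_eq]
  rw [Finset.sum_eq_single (1 : (ZMod m)ˣ)]
  · simp
  · intro u _ hu
    have : ((u⁻¹ : (ZMod m)ˣ) : ZMod m) ≠ 1 := by
      intro h
      apply hu
      have : u⁻¹ = 1 := Units.ext h
      simpa using this
    rw [if_neg this, zero_mul]
  · intro h; exact absurd (Finset.mem_univ _) h

lemma sum_units_eq {m : ℕ} [NeZero m] (χ : DirichletCharacter ℂ m) (F : ZMod m → ℂ) :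
    ∑ b : ZMod m, χ b * F b = ∑ u : (ZMod m)ˣ, χ u * F u := by
  symm
  refine Finset.sum_of_injOn (fun u : (ZMod m)ˣ => (u : ZMod m)) ?_ ?_ ?_ ?_
  · intro u _ v _ h; exact Units.ext h
  · intro u _; simp
  · intro b _ hb
    have : ¬ IsUnit b := by
      rintro ⟨u, hu⟩
      exact hb ⟨u, by simp, hu⟩
    rw [MulChar.map_nonunit χ this, zero_mul]
  · intro u _; rfl

lemma proj_bf_ne_zero {m : ℕ} [NeZero m] (χ : DirichletCharacter ℂ m) (hχ : χ.Odd) :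
    ∃ a, proj χ (bf m) a ≠ 0 := by
  by_contra hcon
  push Not at hcon
  have hχ1 : χ ≠ 1 := by
    rintro rfl
    have h : (1 : DirichletCharacter ℂ m).Even := by
      unfold DirichletCharacter.Even
      exact MulChar.one_apply (isUnit_one.neg)
    exact DirichletCharacter.Odd.not_even _ hχ h
  have hm1 : m ≠ 1 := fun h => hχ1 (DirichletCharacter.level_one' χ h)
  apply DirichletCharacter.LFunction_apply_one_ne_zero hχ1
  rw [DirichletCharacter.LFunction, ZMod.LFunction_def_odd hχ.to_fun]
  have hχ0 : χ 0 = 0 := DirichletCharacter.map_zero' χ hm1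
  have hterm : ∀ b : ZMod m, χ b * HurwitzZeta.hurwitzZetaOdd (ZMod.toAddCircle b) 1 =
      (π * Complex.I) * (χ b * ∑ a : ZMod m, ZMod.stdAddChar (a * b) * bf m a) := by
    intro b
    by_cases hb : b = 0
    · rw [hb, hχ0]; simp
    · have hm0 : (0 : ℝ) < m := Nat.cast_pos.mpr (Nat.pos_of_ne_zero (NeZero.ne m))
      have hv : 0 < b.val := Nat.pos_of_ne_zero (fun h => hb ((ZMod.val_eq_zero b).mp h))
      rw [sum_char_bf b hb, ZMod.toAddCircle_apply, hurwitzZetaOdd_one_eq (by positivity)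
        (by rw [div_lt_one hm0]; exact_mod_cast ZMod.val_lt b)]
      have hI : Complex.I * Complex.I = -1 := Complex.I_mul_I
      linear_combination (χ b * (π / 2 : ℂ) * Complex.cot (π * ((b.val : ℝ) / (m : ℝ) : ℝ))) * hI
  rw [Finset.sum_congr rfl fun b _ => hterm b, ← Finset.mul_sum]
  have hzero : ∑ b : ZMod m, χ b * ∑ a : ZMod m, ZMod.stdAddChar (a * b) * bf m a = 0 := by
    rw [sum_units_eq χ (fun b => ∑ a : ZMod m, ZMod.stdAddChar (a * b) * bf m a)]
    have h1 : ∀ u : (ZMod m)ˣ, ∑ a : ZMod m, ZMod.stdAddChar (a * (u : ZMod m)) * bf m a =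
        ∑ c : ZMod m, ZMod.stdAddChar c * bf m (((u⁻¹ : (ZMod m)ˣ) : ZMod m) * c) := by
      intro u
      refine Fintype.sum_equiv (Units.mulRight u) _ _ fun a => ?_
      simp only [Units.mulRight_apply]
      congr 2
      rw [mul_comm a, ← mul_assoc, Units.inv_mul, one_mul]
    simp_rw [h1, Finset.mul_sum]
    rw [Finset.sum_comm]
    refine Finset.sum_eq_zero fun c _ => ?_
    have h2 := hcon c
    unfold proj at h2
    have h3 : ∑ u : (ZMod m)ˣ, χ u * bf m (((u⁻¹ : (ZMod m)ˣ) : ZMod m) * c) = 0 := by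
      rw [← h2]
      refine Fintype.sum_equiv (Equiv.inv _) _ _ fun u => ?_
      simp
    calc _ = ZMod.stdAddChar c * ∑ u : (ZMod m)ˣ, χ u * bf m (((u⁻¹ : (ZMod m)ˣ) : ZMod m) * c) := by
          rw [Finset.mul_sum]
          refine Finset.sum_congr rfl fun u _ => by ring
      _ = 0 := by rw [h3, mul_zero]
  rw [hzero, mul_zero, mul_zero]

theorem scalar_main {m : ℕ} [NeZero m] (S : (ZMod m → ℂ) →ₗ[ℂ] ℂ)
    (hS : ∀ u : (ZMod m)ˣ, S (fun a => bf m (u * a)) = 0)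
    (g : ZMod m → ℂ) (hg : IsDistr m g) (hodd : ∀ a, g (-a) = -g a) : S g = 0 := by
  have hSB : ∀ χ : DirichletCharacter ℂ m, S (proj χ (bf m)) = 0 := by
    intro χ
    have : proj χ (bf m) = ∑ u : (ZMod m)ˣ,
        χ ((u⁻¹ : (ZMod m)ˣ) : ZMod m) • (fun a => bf m (u * a)) := by
      ext a
      simp [proj, Finset.sum_apply]
    rw [this, map_sum]
    refine Finset.sum_eq_zero fun u _ => ?_
    rw [map_smul, hS u, smul_zero]
  have hSg : ∀ χ : DirichletCharacter ℂ m, S (proj χ g) = 0 := by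
    intro χ
    rcases χ.even_or_odd with hχ | hχ
    · have : proj χ g = 0 := by ext a; exact proj_even χ hχ hodd a
      rw [this, map_zero]
    · have hχ1 : χ ≠ 1 := by
        rintro rfl
        have h : (1 : DirichletCharacter ℂ m).Even := by
          unfold DirichletCharacter.Even
          exact MulChar.one_apply (isUnit_one.neg)
        exact DirichletCharacter.Odd.not_even _ hχ h
      set a0 : ZMod m := ((m / χ.conductor : ℕ) : ZMod m) with ha0
      have hB0 : proj χ (bf m) a0 ≠ 0 := by
        intro h
        obtain ⟨a, ha⟩ := proj_bf_ne_zero χ hχ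
        exact ha (distr_uniq χ hχ1 _ (proj_distr χ (bf_distr m)) (proj_equiv χ _) h a)
      have hcomb := distr_uniq χ hχ1
        (fun a => proj χ (bf m) a0 * proj χ g a - proj χ g a0 * proj χ (bf m) a)
        ((proj_distr χ hg).lin (proj_distr χ (bf_distr m)) _ _)
        (fun u a => by simp only [proj_equiv]; ring) (by ring)
      have hfun : proj χ (bf m) a0 • proj χ g = proj χ g a0 • proj χ (bf m) := by
        ext a
        simpa [sub_eq_zero] using hcomb a
      have h4 := congrArg S hfun
      rw [map_smul, map_smul, hSB, smul_zero, smul_eq_mul] at h4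
      exact (mul_eq_zero.mp h4).resolve_left hB0
  have htot : (m.totient : ℂ) • g = ∑ χ : DirichletCharacter ℂ m, proj χ g := by
    ext a
    rw [Finset.sum_apply, sum_proj]; simp
  have h5 := congrArg S htot
  rw [map_smul, map_sum, Finset.sum_eq_zero fun χ _ => hSg χ, smul_eq_mul] at h5
  refine (mul_eq_zero.mp h5).resolve_left ?_
  exact Nat.cast_ne_zero.mpr (Nat.totient_pos.mpr (Nat.pos_of_ne_zero (NeZero.ne m))).ne'

lemma gauss_mult (d : ℕ) (hd : 0 < d) (x : ℝ) (hx : 0 < x) :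
    Real.log (Real.Gamma x) = (x - 1) * Real.log d
      + ∑ k ∈ Finset.range d, Real.log (Real.Gamma ((x + k) / d))
      - ∑ k ∈ Finset.range d, Real.log (Real.Gamma ((1 + k) / d)) := by
  have hd' : (0 : ℝ) < d := by exact_mod_cast hd
  set f : ℝ → ℝ := fun x => Real.exp ((x - 1) * Real.log d
      + ∑ k ∈ Finset.range d, Real.log (Real.Gamma ((x + k) / d))
      - ∑ k ∈ Finset.range d, Real.log (Real.Gamma ((1 + k) / d))) with hf
  have key : Set.EqOn f Real.Gamma (Set.Ioi 0) := by
    apply Real.eq_Gamma_of_log_convex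
    · have h1 : (Real.log ∘ f) = fun x => (x - 1) * Real.log d
          + ∑ k ∈ Finset.range d, Real.log (Real.Gamma ((x + k) / d))
          - ∑ k ∈ Finset.range d, Real.log (Real.Gamma ((1 + k) / d)) := by
        funext x
        simp only [hf, Function.comp, Real.log_exp]
      have hG : ∀ k : ℕ, ConvexOn ℝ (Set.Ioi 0)
          (fun x : ℝ => Real.log (Real.Gamma ((x + k) / d))) := by
        intro k
        refine ⟨convex_Ioi 0, ?_⟩
        intro x hx y hy a b ha hb hab
        have hx' : (x + k) / d ∈ Set.Ioi (0:ℝ) := by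
          have : (0:ℝ) < x := hx
          rw [Set.mem_Ioi]
          positivity
        have hy' : (y + k) / d ∈ Set.Ioi (0:ℝ) := by
          have : (0:ℝ) < y := hy
          rw [Set.mem_Ioi]
          positivity
        have := Real.convexOn_log_Gamma.2 hx' hy' ha hb hab
        simp only [Function.comp, smul_eq_mul] at this ⊢
        convert this using 3
        have hb' : b = 1 - a := by linarith
        subst hb'
        field_simp
        ring
      have hS : ∀ N : ℕ, ConvexOn ℝ (Set.Ioi 0)
          (fun x : ℝ => ∑ k ∈ Finset.range N, Real.log (Real.Gamma ((x + k) / d))) := by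
        intro N
        induction N with
        | zero => simpa using convexOn_const (0:ℝ) (convex_Ioi 0)
        | succ n ih =>
          simp only [Finset.sum_range_succ]
          exact ih.add (hG n)
      rw [h1]
      refine ⟨convex_Ioi 0, ?_⟩
      intro x hx y hy a b ha hb hab
      have := (hS d).2 hx hy ha hb hab
      simp only [smul_eq_mul] at this ⊢
      have hb' : b = 1 - a := by linarith
      subst hb'
      nlinarith [this]
    · intro y hy
      have hgy : 0 < Real.Gamma (y / d) := Real.Gamma_pos_of_pos (by positivity)
      have e1 : ∑ k ∈ Finset.range d, Real.log (Real.Gamma ((y + 1 + k) / d))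
          = ∑ k ∈ Finset.range d, Real.log (Real.Gamma ((y + k) / d)) + Real.log (y / d) := by
        have a1 := Finset.sum_range_succ (fun k : ℕ => Real.log (Real.Gamma ((y + k) / d))) d
        have a2 := Finset.sum_range_succ' (fun k : ℕ => Real.log (Real.Gamma ((y + k) / d))) d
        have a3 : Real.Gamma ((y + d) / d) = (y / d) * Real.Gamma (y / d) := by
          rw [← Real.Gamma_add_one (by positivity)]
          congr 1
          field_simp
        rw [a3, Real.log_mul (by positivity) hgy.ne'] at a1
        have a4 : ∑ k ∈ Finset.range d, Real.log (Real.Gamma ((y + 1 + k) / d))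
           = ∑ k ∈ Finset.range d, Real.log (Real.Gamma ((y + ((k+1 : ℕ):ℝ)) / d)) := by
          apply Finset.sum_congr rfl
          intro k _
          push_cast
          ring_nf
        simp only [Nat.cast_zero, add_zero] at a2
        rw [a4]
        linarith
      simp only [hf]
      rw [e1, Real.log_div hy.ne' hd'.ne']
      conv_rhs => rw [← Real.exp_log hy, ← Real.exp_add]
      simp only [Real.exp_log hy]
      congr 1
      ring
    · intro y _
      exact Real.exp_pos _
    · simp [hf]
  have := key (show x ∈ Set.Ioi 0 from hx)
  rw [← this]
  simp only [hf, Real.log_exp]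

/-- Real numbers whose exponential is algebraic. -/
def algLog : Submodule ℚ ℝ where
  carrier := {x | IsAlgebraic ℚ (Real.exp x)}
  add_mem' := by
    intro a b ha hb
    show IsAlgebraic ℚ _
    rw [Real.exp_add]
    exact IsAlgebraic.mul ha hb
  zero_mem' := by
    show IsAlgebraic ℚ _
    rw [Real.exp_zero]
    exact isAlgebraic_one
  smul_mem' := by
    intro c x hx
    have hx : IsAlgebraic ℚ (Real.exp x) := hx
    show IsAlgebraic ℚ _
    have hc : (0:ℝ) < c.den := by exact_mod_cast c.den_pos
    apply IsAlgebraic.of_pow c.den_pos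
    have : Real.exp (c • x) ^ c.den = Real.exp x ^ c.num := by
      rw [← Real.exp_nat_mul, ← Real.rpow_intCast, ← Real.exp_mul]
      congr 1
      rw [Rat.smul_def, ← mul_assoc, mul_comm x]
      congr 1
      exact_mod_cast Rat.den_mul_eq_num c
    rw [this]
    cases c.num with
    | ofNat k => simpa using hx.pow k
    | negSucc k => rw [zpow_negSucc]; exact (hx.pow _).inv

lemma mem_algLog {y : ℝ} (hy : 0 < y) (h : IsAlgebraic ℚ y) : Real.log y ∈ algLog := by
  show IsAlgebraic ℚ _
  rwa [Real.exp_log hy]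

lemma log_rat_mem (r : ℚ) (hr : 0 < r) : Real.log (r:ℝ) ∈ algLog :=
  mem_algLog (by exact_mod_cast hr) (isAlgebraic_algebraMap (A := ℝ) r)

lemma reflection_mem (r : ℚ) (h0 : 0 < r) (h1 : r < 1) :
    Real.log (Real.Gamma r) + Real.log (Real.Gamma (1 - r)) - Real.log π ∈ algLog := by
  have h0' : (0:ℝ) < r := by exact_mod_cast h0
  have h1' : (r:ℝ) < 1 := by exact_mod_cast h1
  have g0 := Real.Gamma_pos_of_pos h0'
  have g1 : 0 < Real.Gamma (1 - r) := Real.Gamma_pos_of_pos (by linarith)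
  have hs : 0 < Real.sin (π * r) := Real.sin_pos_of_pos_of_lt_pi (by positivity)
    (by nlinarith [Real.pi_pos])
  rw [← Real.log_mul g0.ne' g1.ne', Real.Gamma_mul_Gamma_one_sub,
    Real.log_div Real.pi_pos.ne' hs.ne']
  have : Real.log π - Real.log (Real.sin (π * r)) - Real.log π = - Real.log (Real.sin (π * r)) := by
    ring
  rw [this]
  apply Submodule.neg_mem
  apply mem_algLog hs
  have := Real.isAlgebraic_sin_rat_mul_pi r
  rw [mul_comm]
  exact this.extendScalars (Int.cast_injective)

/-- The values on naturals. -/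
noncomputable def Gf (m : ℕ) (φ : ℝ →ₗ[ℚ] ℚ) (t : ℕ) : ℂ :=
  ((φ (Real.log (Real.Gamma ((t:ℝ) / m))) - φ (Real.log π) / 2 : ℚ) : ℂ)


lemma phi_zero (φ : ℝ →ₗ[ℚ] ℚ) (hφ : algLog ≤ LinearMap.ker φ) {x : ℝ} (hx : x ∈ algLog) : φ x = 0 := hφ hx

lemma phi_reflect (φ : ℝ →ₗ[ℚ] ℚ) (hφ : algLog ≤ LinearMap.ker φ) (r : ℚ) (h0 : 0 < r) (h1 : r < 1) :
    φ (Real.log (Real.Gamma r)) + φ (Real.log (Real.Gamma (1 - r))) = φ (Real.log π) := by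
  have := phi_zero φ hφ (reflection_mem r h0 h1)
  rw [map_sub, map_add] at this
  linarith

lemma phi_const (φ : ℝ →ₗ[ℚ] ℚ) (hφ : algLog ≤ LinearMap.ker φ) (d : ℕ) (hd : 0 < d) :
    ∑ k ∈ Finset.range d, φ (Real.log (Real.Gamma ((1 + k) / d)))
      = ((d : ℚ) - 1) / 2 * φ (Real.log π) := by
  obtain ⟨c, rfl⟩ : ∃ c, d = c + 1 := ⟨d - 1, by omega⟩
  have hlast : φ (Real.log (Real.Gamma ((1 + (c:ℝ)) / ((c + 1 : ℕ):ℝ)))) = 0 := by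
    have : ((1 + (c:ℝ)) / ((c + 1 : ℕ):ℝ)) = 1 := by
      push_cast
      rw [add_comm]
      exact div_self (by positivity)
    rw [this]
    simp
  rw [Finset.sum_range_succ, hlast, add_zero]
  set F : ℕ → ℚ := fun k => φ (Real.log (Real.Gamma ((1 + (k:ℝ)) / ((c + 1 : ℕ):ℝ)))) with hF
  have h1 : ∑ k ∈ Finset.range c, F (c - 1 - k) = ∑ k ∈ Finset.range c, F k :=
    Finset.sum_range_reflect F c
  have h2 : ∑ k ∈ Finset.range c, (F k + F (c - 1 - k)) = c * φ (Real.log π) := by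
    rw [Finset.sum_congr rfl (g := fun _ => φ (Real.log π))]
    · simp
    · intro k hk
      have hk := Finset.mem_range.mp hk
      have hc : (0:ℚ) < c + 1 := by positivity
      have hkq : (k:ℚ) + 1 ≤ c := by exact_mod_cast hk
      have := phi_reflect φ hφ ((1 + k) / (c + 1)) (by positivity)
        (by rw [div_lt_one hc]; linarith)
      rw [← this]
      simp only [hF]
      have e1 : ((c - 1 - k : ℕ) : ℝ) = c - 1 - k := by
        have : c - 1 - k = c - (1 + k) := by omega
        rw [this, Nat.cast_sub (by omega)]
        push_cast
        ring
      rw [e1]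
      have hcr : (0:ℝ) < c + 1 := by positivity
      congr 4
      · push_cast
        rfl
      · push_cast
        field_simp
        ring
  rw [Finset.sum_add_distrib, h1] at h2
  push_cast
  linarith

lemma phi_gauss (φ : ℝ →ₗ[ℚ] ℚ) (hφ : algLog ≤ LinearMap.ker φ) (d : ℕ) (hd : 0 < d) (r : ℚ) (hr : 0 < r) :
    φ (Real.log (Real.Gamma r)) =
      ∑ k ∈ Finset.range d, φ (Real.log (Real.Gamma ((r + k) / d)))
        - ((d : ℚ) - 1) / 2 * φ (Real.log π) := by
  rw [gauss_mult d hd r (by exact_mod_cast hr), map_sub, map_add, map_sum, map_sum,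
    phi_const φ hφ d hd]
  have : φ (((r:ℝ) - 1) * Real.log d) = 0 := by
    apply phi_zero φ hφ
    have h := algLog.smul_mem (r - 1) (log_rat_mem (d:ℚ) (by exact_mod_cast hd))
    rw [Rat.smul_def] at h
    push_cast at h
    exact h
  rw [this, zero_add]

lemma phi_shift (φ : ℝ →ₗ[ℚ] ℚ) (hφ : algLog ≤ LinearMap.ker φ) (r : ℚ) (hr : 0 < r) :
    φ (Real.log (Real.Gamma (r + 1))) = φ (Real.log (Real.Gamma r)) := by
  have hr' : (0:ℝ) < r := by exact_mod_cast hr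
  rw [Real.Gamma_add_one hr'.ne', Real.log_mul hr'.ne' (Real.Gamma_pos_of_pos hr').ne', map_add,
    phi_zero φ hφ (log_rat_mem r hr), zero_add]

lemma Gf_distr (φ : ℝ →ₗ[ℚ] ℚ) (hφ : algLog ≤ LinearMap.ker φ) (m : ℕ) (hm : 0 < m) : ∀ d e, d*e=m → ∀ t, 0<t → t<e →
    ∑ k ∈ Finset.range d, Gf m φ (t + k*e) = Gf m φ (d*t) := by
  intro d e hde t ht hte
  have hd : 0 < d := Nat.pos_of_mul_pos_right (hde ▸ hm) |> fun h => h
  have he : 0 < e := by omega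
  have hdr : (0:ℝ) < d := by exact_mod_cast hd
  have her : (0:ℝ) < e := by exact_mod_cast he
  have h := phi_gauss φ hφ d hd ((t:ℚ)/e) (by positivity)
  have e1 : ((d * t : ℕ) : ℝ) / m = (((t:ℚ)/e : ℚ) : ℝ) := by
    rw [← hde]
    push_cast
    field_simp
  have e2 : ∀ k : ℕ, ((t + k * e : ℕ) : ℝ) / m = ((((t:ℚ)/e : ℚ) : ℝ) + k) / d := by
    intro k
    rw [← hde]
    push_cast
    field_simp
  unfold Gf
  rw [← Rat.cast_sum, e1, h]
  congr 1
  simp only [e2, Finset.sum_sub_distrib, Finset.sum_const, Finset.card_range, nsmul_eq_mul]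
  ring

lemma L_odd (φ : ℝ →ₗ[ℚ] ℚ) (hφ : algLog ≤ LinearMap.ker φ) (m : ℕ) [NeZero m] (a : ZMod m) :
    (fun a : ZMod m => if a = 0 then 0 else Gf m φ a.val) (-a)
      = - (fun a : ZMod m => if a = 0 then 0 else Gf m φ a.val) a := by
  by_cases h : a = 0
  · simp [h]
  · have hm : 0 < m := Nat.pos_of_ne_zero (NeZero.ne m)
    have hmq : (0:ℚ) < m := by exact_mod_cast hm
    have hv : 0 < a.val := Nat.pos_of_ne_zero (by simpa [ZMod.val_eq_zero] using h)
    have hlt := ZMod.val_lt a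
    have hltq : (a.val:ℚ) < m := by exact_mod_cast hlt
    have hr := phi_reflect φ hφ ((a.val:ℚ)/m) (by positivity) (by rw [div_lt_one hmq]; exact hltq)
    have : NeZero a := ⟨h⟩
    simp only [neg_eq_zero, h, if_false, Gf, ZMod.val_neg_of_ne_zero]
    rw [← Rat.cast_neg]
    congr 1
    have e1 : ((m - a.val : ℕ):ℝ) / m = 1 - (((a.val:ℚ)/m : ℚ):ℝ) := by
      rw [Nat.cast_sub hlt.le]
      push_cast
      have : (0:ℝ) < m := by exact_mod_cast hm
      field_simp
    have e2 : (a.val:ℝ) / m = (((a.val:ℚ)/m : ℚ):ℝ) := by push_cast; rfl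
    rw [e1, e2]
    linarith


/-- The odd distribution attached to `φ ∘ log Γ`. -/
noncomputable def Lf (n : ℕ) (φ : ℝ →ₗ[ℚ] ℚ) (a : ZMod n) : ℂ :=
  if a = 0 then 0 else Gf n φ a.val

lemma Lf_int (φ : ℝ →ₗ[ℚ] ℚ) (hφ : algLog ≤ LinearMap.ker φ) (n : ℕ) [NeZero n] (a : ℤ)
    (h0 : 0 < a) (h2 : a < 2 * n) (ha : a ≠ n) :
    Lf n φ (a : ZMod n)
      = ((φ (Real.log (Real.Gamma ((a:ℝ) / n))) - φ (Real.log π) / 2 : ℚ) : ℂ) := by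
  have hn : 0 < n := Nat.pos_of_ne_zero (NeZero.ne n)
  have hnr : (0:ℝ) < n := by exact_mod_cast hn
  have hv : (((a : ZMod n).val : ℤ)) = a % n := ZMod.val_intCast a
  have hne : (a : ZMod n) ≠ 0 := by
    intro h
    rw [ZMod.intCast_zmod_eq_zero_iff_dvd] at h
    obtain ⟨c, rfl⟩ := h
    have hn' : (0:ℤ) < n := by exact_mod_cast hn
    have c1 : 0 < c := by
      by_contra hc
      nlinarith
    have c2 : c < 2 := by
      by_contra hc
      nlinarith
    have : c = 1 := by omega
    subst this
    simp at ha
  rw [Lf, if_neg hne, Gf]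
  rcases lt_or_gt_of_ne ha with hlt | hgt
  · rw [Int.emod_eq_of_lt h0.le hlt] at hv
    have : (((a : ZMod n).val : ℝ)) = a := by exact_mod_cast hv
    rw [this]
  · have hv2 : (((a : ZMod n).val : ℤ)) = a - n := by
      rw [hv, ← Int.sub_emod_right]
      exact Int.emod_eq_of_lt (by omega) (by omega)
    have hvr : (((a : ZMod n).val : ℝ)) = a - n := by exact_mod_cast hv2
    have hp : (0:ℚ) < ((a:ℚ) - n) / n := by
      have h1 : (n:ℚ) < a := by exact_mod_cast hgt
      have h2 : (0:ℚ) < n := by exact_mod_cast hn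
      exact div_pos (by linarith) h2
    have := phi_shift φ hφ _ hp
    have e1 : ((((a:ℚ) - n) / n : ℚ) : ℝ) + 1 = (a:ℝ) / n := by
      push_cast
      field_simp
      ring
    have e2 : ((((a:ℚ) - n) / n : ℚ) : ℝ) = ((a:ℝ) - n) / n := by
      push_cast
      rfl
    rw [e1, e2] at this
    rw [hvr, this]

lemma weight_bf (n : ℕ) [NeZero n] (a : ℤ) (h1 : (a : ZMod n) ≠ 0) (h2 : 2 * (a : ZMod n) ≠ 0) :
    (((Int.fract ((a:ℝ) / (n:ℝ)) + Int.fract ((a:ℝ) / (n:ℝ))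
      + Int.fract (-((2 * a : ℤ):ℝ) / (n:ℝ)) : ℝ)) : ℂ)
      = 2 * bf n (a : ZMod n) - bf n (2 * (a : ZMod n)) + 3 / 2 := by
  have hfr : ∀ b : ℤ, Int.fract ((b:ℝ) / (n:ℝ)) = ((b : ZMod n).val : ℝ) / n := by
    intro b
    rw [Int.fract_div_intCast_eq_div_intCast_mod]
    congr 1
    exact_mod_cast (ZMod.val_intCast b).symm
  have hnr : (n:ℝ) ≠ 0 := by exact_mod_cast NeZero.ne n
  have e2 : ((2 * a : ℤ) : ZMod n) = 2 * (a : ZMod n) := by push_cast; rfl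
  have hne : Int.fract (((2 * a : ℤ):ℝ) / (n:ℝ)) ≠ 0 := by
    rw [hfr, e2]
    apply div_ne_zero _ hnr
    rw [Nat.cast_ne_zero, Ne, ZMod.val_eq_zero]
    exact h2
  rw [neg_div, Int.fract_neg hne, hfr, hfr, e2, bf, bf, if_neg h1, if_neg h2]
  push_cast
  ring

/-- The linear functional. -/
noncomputable def Sf (n q : ℕ) (i : Fin q → ℤ) : (ZMod n → ℂ) →ₗ[ℂ] ℂ where
  toFun h := ∑ j, (2 * h (i j : ZMod n) - h (2 * (i j : ZMod n)))
  map_add' := by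
    intro f g
    rw [← Finset.sum_add_distrib]
    apply Finset.sum_congr rfl
    intro j _
    simp only [Pi.add_apply]
    ring
  map_smul' := by
    intro c f
    simp only [Pi.smul_apply, smul_eq_mul, RingHom.id_apply]
    rw [Finset.mul_sum]
    apply Finset.sum_congr rfl
    intro j _
    ring

lemma weight_int (x y : ℝ) (hy : y = -2 * x) :
    ∃ N : ℤ, Int.fract x + Int.fract x + Int.fract y = N := by
  refine ⟨-2 * ⌊x⌋ - ⌊y⌋, ?_⟩
  unfold Int.fract
  push_cast
  rw [hy]
  ring

theorem period_of_tate_class_is_algebraic_aux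
    (n : ℕ) (hm : 3 ≤ n) (hodd : Odd n) (q : ℕ)
    (i : Fin q → ℤ) (hi : ∀ j, 1 ≤ i j ∧ i j ≤ (n:ℤ) - 1)
    (hweight : ∀ u : ℤ, IsCoprime u (n:ℤ) →
      ∑ j, (Int.fract (((u * i j : ℤ) : ℝ) / (n:ℝ)) + Int.fract (((u * i j : ℤ) : ℝ) / (n:ℝ))
        + Int.fract (((-2 * u * i j : ℤ) : ℝ) / (n:ℝ))) = 3 * (q:ℝ) / 2) :
    IsAlgebraic ℚ ((2 * (π:ℂ) * Complex.I) ^ (-((q:ℤ) / 2)) *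
      ∏ r, Complex.Gamma (((i r : ℤ):ℂ) / (n:ℂ)) ^ 2
        * (Complex.Gamma (((2 * i r : ℤ):ℂ) / (n:ℂ)))⁻¹) := by
  have : NeZero n := ⟨by omega⟩
  have hnr : (0:ℝ) < n := by
    have : 0 < n := by omega
    exact_mod_cast this
  have h2u : IsUnit (2 : ZMod n) := by
    have := (ZMod.isUnit_iff_coprime 2 n).mpr (Nat.coprime_two_left.mpr hodd)
    exact_mod_cast this
  have hine : ∀ j, ((i j : ℤ) : ZMod n) ≠ 0 := by
    intro j h
    rw [ZMod.intCast_zmod_eq_zero_iff_dvd] at h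
    have := Int.le_of_dvd (by have := (hi j).1; omega) h
    have := (hi j).2
    omega
  obtain ⟨p, hp⟩ : ∃ p : ℕ, q = 2 * p := by
    have h := hweight 1 isCoprime_one_left
    have hN : ∀ j, ∃ N : ℤ, Int.fract (((1 * i j : ℤ) : ℝ) / (n:ℝ))
        + Int.fract (((1 * i j : ℤ) : ℝ) / (n:ℝ))
        + Int.fract (((-2 * 1 * i j : ℤ) : ℝ) / (n:ℝ)) = N := by
      intro j
      apply weight_int
      push_cast
      ring
    choose N hN using hN
    simp only [hN] at h
    have h3 : 2 * (∑ j, N j) = 3 * (q:ℤ) := by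
      have : 2 * (∑ j, (N j:ℝ)) = 3 * (q:ℝ) := by rw [h]; ring
      exact_mod_cast this
    exact ⟨q / 2, by omega⟩
  have hS : ∀ u : (ZMod n)ˣ, Sf n q i (fun a => bf n (u * a)) = 0 := by
    intro u
    have hc : IsCoprime ((u.val.val : ℕ) : ℤ) (n:ℤ) := by
      rw [Nat.isCoprime_iff_coprime]
      exact ZMod.val_coe_unit_coprime u
    have h := hweight _ hc
    have h' := congrArg (fun x : ℝ => (x : ℂ)) h
    simp only [Complex.ofReal_sum] at h'
    have hu : ((((u.val.val : ℕ) : ℤ)) : ZMod n) = u := by simp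
    have hterm : ∀ j, (((Int.fract (((((u.val.val : ℕ) : ℤ) * i j : ℤ) : ℝ) / (n:ℝ))
        + Int.fract (((((u.val.val : ℕ) : ℤ) * i j : ℤ) : ℝ) / (n:ℝ))
        + Int.fract (((-2 * ((u.val.val : ℕ) : ℤ) * i j : ℤ) : ℝ) / (n:ℝ)) : ℝ)) : ℂ)
        = 2 * bf n (u * (i j : ZMod n)) - bf n (u * (2 * (i j : ZMod n))) + 3 / 2 := by
      intro j
      have a1 : ((((u.val.val : ℕ) : ℤ) * i j : ℤ) : ZMod n) = u * (i j : ZMod n) := by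
        rw [Int.cast_mul, hu]
      have a2 : (u : ZMod n) * (i j : ZMod n) ≠ 0 := by
        rw [Ne, Units.mul_right_eq_zero]
        exact hine j
      have a3 : 2 * ((u : ZMod n) * (i j : ZMod n)) ≠ 0 := by
        rw [Ne, h2u.mul_right_eq_zero]
        exact a2
      have := weight_bf n (((u.val.val : ℕ) : ℤ) * i j) (by rw [a1]; exact a2)
        (by rw [a1]; exact a3)
      rw [a1] at this
      have e : (-2 * ((u.val.val : ℕ) : ℤ) * i j : ℤ) = -(2 * (((u.val.val : ℕ) : ℤ) * i j)) := by
        ring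
      rw [e, Int.cast_neg, this]
      congr 3
      ring
    rw [Finset.sum_congr rfl (fun j _ => hterm j), Finset.sum_add_distrib] at h'
    simp only [Finset.sum_const, Finset.card_univ, Fintype.card_fin, nsmul_eq_mul] at h'
    show ∑ j : Fin q, (2 * bf n (u * (i j : ZMod n)) - bf n (u * (2 * (i j : ZMod n)))) = 0
    push_cast at h'
    linear_combination h'
  set X : ℝ := ∑ r, (2 * Real.log (Real.Gamma ((i r : ℝ) / n))
    - Real.log (Real.Gamma (((2 * i r : ℤ) : ℝ) / n))) - p * Real.log π with hX
  have hXalg : X ∈ algLog := by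
    by_contra hX'
    obtain ⟨φ, hφX, hφ⟩ := Submodule.exists_le_ker_of_notMem hX'
    apply hφX
    have hmain := scalar_main (Sf n q i) hS (Lf n φ)
      (distr_of_nat (Gf n φ) (Gf_distr φ hφ n (by omega))) (L_odd φ hφ n)
    have hSL : Sf n q i (Lf n φ) = ((φ X : ℚ) : ℂ) := by
      show ∑ j, (2 * Lf n φ (i j : ZMod n) - Lf n φ (2 * (i j : ZMod n))) = _
      have hj : ∀ j, (2 * Lf n φ (i j : ZMod n) - Lf n φ (2 * (i j : ZMod n)))
          = ((2 * φ (Real.log (Real.Gamma ((i j : ℝ) / n)))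
            - φ (Real.log (Real.Gamma (((2 * i j : ℤ) : ℝ) / n))) - φ (Real.log π) / 2 : ℚ) : ℂ) := by
        intro j
        have := hi j
        have e : (2 * (i j : ZMod n)) = ((2 * i j : ℤ) : ZMod n) := by push_cast; rfl
        rw [e, Lf_int φ hφ n (i j) (by omega) (by omega) (by omega),
          Lf_int φ hφ n (2 * i j) (by omega) (by omega)
            (by obtain ⟨k, hk⟩ := hodd; omega)]
        push_cast
        ring
      rw [Finset.sum_congr rfl (fun j _ => hj j), ← Rat.cast_sum]
      congr 1
      have hpm : φ ((p:ℝ) * Real.log π) = p * φ (Real.log π) := by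
        rw [← nsmul_eq_mul, map_nsmul, nsmul_eq_mul]
      have h2m : ∀ x : ℝ, φ (2 * x) = 2 * φ x := by
        intro x
        rw [two_mul, map_add, two_mul]
      rw [hX, map_sub, map_sum, hpm, Finset.sum_sub_distrib]
      simp only [map_sub, h2m, Finset.sum_const, Finset.card_univ, Fintype.card_fin, nsmul_eq_mul]
      have hpq : (q:ℚ) = 2 * p := by exact_mod_cast hp
      rw [hpq]
      ring
    rw [hSL] at hmain
    exact_mod_cast hmain
  have hXe : IsAlgebraic ℚ ((Real.exp X : ℝ) : ℂ) := by
    have : IsAlgebraic ℚ (Real.exp X) := hXalg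
    exact this.algebraMap (A := ℂ)
  have hexp : Real.exp X = (π ^ p)⁻¹ * ∏ r, (Real.Gamma ((i r : ℝ) / n) ^ 2
      * (Real.Gamma (((2 * i r : ℤ) : ℝ) / n))⁻¹) := by
    rw [hX, Real.exp_sub, Real.exp_sum, Real.exp_nat_mul, Real.exp_log Real.pi_pos,
      div_eq_mul_inv, mul_comm]
    congr 1
    apply Finset.prod_congr rfl
    intro r _
    have h1 : (1:ℝ) ≤ i r := by exact_mod_cast (hi r).1
    have g1 : 0 < Real.Gamma ((i r : ℝ) / n) := Real.Gamma_pos_of_pos (by positivity)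
    have g2 : 0 < Real.Gamma (((2 * i r : ℤ) : ℝ) / n) :=
      Real.Gamma_pos_of_pos (by push_cast; positivity)
    rw [Real.exp_sub, Real.exp_log g2, div_eq_mul_inv]
    congr 1
    have := Real.exp_nat_mul (Real.log (Real.Gamma ((i r : ℝ) / n))) 2
    rw [Real.exp_log g1] at this
    exact_mod_cast this
  have hfin : ((2 * (π:ℂ) * Complex.I) ^ (-((q:ℤ) / 2)) *
      ∏ r, Complex.Gamma (((i r : ℤ):ℂ) / (n:ℂ)) ^ 2
        * (Complex.Gamma (((2 * i r : ℤ):ℂ) / (n:ℂ)))⁻¹)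
      = ((2 * Complex.I) ^ p)⁻¹ * ((Real.exp X : ℝ) : ℂ) := by
    have hq2 : (q:ℤ) / 2 = p := by omega
    rw [hq2, hexp, zpow_neg, zpow_natCast]
    push_cast
    simp only [← Complex.Gamma_ofReal]
    push_cast
    rw [mul_pow, mul_pow, mul_pow]
    ring
  rw [hfin]
  refine IsAlgebraic.mul (IsAlgebraic.inv (IsAlgebraic.pow (IsAlgebraic.mul ?_ ?_) p)) hXe
  · exact_mod_cast isAlgebraic_algebraMap (A := ℂ) (2:ℚ)
  · exact IsAlgebraic.of_pow (n := 2) (by norm_num) (by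
      rw [Complex.I_sq]
      exact_mod_cast isAlgebraic_algebraMap (A := ℂ) (-1:ℚ))

/-- Let `m ≥ 3` be odd, `q ≥ 1`, `1 ≤ i_j ≤ m - 1`, and
suppose the weight `⟨uα⟩ = Σ_j ({u i_j/m} + {u i_j/m} + {-2 u i_j/m})` equals
`3q/2` for every `u` coprime to `m` (so in particular `q` is even).  Then the
period `(2πi)^{-q/2} · Π_r Γ(i_r/m)² Γ(2 i_r/m)⁻¹` is algebraic over `ℚ`. -/
theorem period_of_tate_class_is_algebraic
    (m : ℤ) (hm : 3 ≤ m) (hodd : Odd m)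
    (q : ℕ) (hq : 1 ≤ q)
    (i : Fin q → ℤ) (hi : ∀ j, 1 ≤ i j ∧ i j ≤ m - 1)
    (hweight : ∀ u : ℤ, IsCoprime u m →
      ∑ j : Fin q,
        (Int.fract (((u * i j : ℤ) : ℝ) / (m : ℝ)) +
         Int.fract (((u * i j : ℤ) : ℝ) / (m : ℝ)) +
         Int.fract (((-2 * u * i j : ℤ) : ℝ) / (m : ℝ))) = 3 * q / 2) :
    IsAlgebraic ℚ
      ((2 * (π : ℂ) * Complex.I) ^ (-((q : ℤ) / 2)) *
        ∏ r : Fin q,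
          Complex.Gamma (((i r : ℤ) : ℂ) / (m : ℂ)) ^ 2 *
            (Complex.Gamma (((2 * i r : ℤ) : ℂ) / (m : ℂ)))⁻¹) := by
  obtain ⟨n, rfl⟩ := Int.eq_ofNat_of_zero_le (show 0 ≤ m by omega)
  have h := period_of_tate_class_is_algebraic_aux n (by omega) (by exact_mod_cast hodd) q i hi
    (by simpa only [Int.cast_natCast] using hweight)
  simpa only [Int.cast_natCast] using h
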